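/- There exist absolute constants C₀, C_d, C_T > 0 such that the following holds. Let M ∈ ℝ^{m×n} (m ≥ n) be a rank-r μ-incoherent matrix, α = m/n, κ = Σmax/Σmin, δ = Σmin/(C_d·r^{3/2}·κ), β_T = √(C_T·r·Σmax). Let Ω be drawn uniformly at random among all subsets of [m]×[n] of cardinality S with S ≥ C₀·α·n·r·κ²·max{μ·log n, √α·μ²·r⁶·κ⁴}, and p = S/(mn). Then with probability at least 1 − 1/(2n⁴): for every (X,Y) ∈ K₁ ∩ K₂ ∩ K(δ) there exist U ∈ ℝ^{m×r}, V ∈ ℝ^{n×r} with U·Vᵀ = M, ‖U^{(i)}‖² ≤ (3/2)·(rμ/m)·β_T² for all i, ‖V^{(j)}‖² ≤ (3/2)·(rμ/n)·β_T² for all j, ‖U − X‖_F·‖V − Y‖_F ≤ 25·√r·(β_T²/Σmin²)·‖M − XYᵀ‖_F², and ‖P_Ω((U − X)(V − Y)ᵀ)‖_F² ≤ (p/25)·‖M − X·Yᵀ‖_F². -/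

import Mathlib

open Matrix
open scoped Classical

noncomputable section

/-- Frobenius norm of a real matrix. -/
def frob {m n : ℕ} (A : Matrix (Fin m) (Fin n) ℝ) : ℝ :=
  Real.sqrt (∑ i, ∑ j, A i j ^ 2)

/-- Euclidean norm of the `i`-th row of a matrix. -/
def rowNorm {m n : ℕ} (A : Matrix (Fin m) (Fin n) ℝ) (i : Fin m) : ℝ :=
  Real.sqrt (∑ j, A i j ^ 2)

/-- Frobenius inner product `⟨A,B⟩ = trace(AᵀB)`. -/
def finner {m n : ℕ} (A B : Matrix (Fin m) (Fin n) ℝ) : ℝ :=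
  ∑ i, ∑ j, A i j * B i j

/-- Projection onto the set of entries indexed by `Ω` (other entries are set to `0`). -/
def projOmega {m n : ℕ} (Ω : Finset (Fin m × Fin n)) (A : Matrix (Fin m) (Fin n) ℝ) :
    Matrix (Fin m) (Fin n) ℝ :=
  Matrix.of fun i j => if (i, j) ∈ Ω then A i j else 0

/-- `G₀(z) = (max{0, z-1})²`. -/
def G0 (z : ℝ) : ℝ := max 0 (z - 1) ^ 2

/-- `G₀′(z) = 2·max{0, z-1}`. -/
def G0' (z : ℝ) : ℝ := 2 * max 0 (z - 1)

/-- The matrix whose `i`-th row is the `i`-th row of `A` and whose other rows vanish. -/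
def rowMat {m n : ℕ} (A : Matrix (Fin m) (Fin n) ℝ) (i : Fin m) :
    Matrix (Fin m) (Fin n) ℝ :=
  Matrix.of fun i' j => if i' = i then A i j else 0

/-- The regularizer `G(X,Y)`. -/
def Greg {m n r : ℕ} (ρ β1 β2 βT : ℝ) (X : Matrix (Fin m) (Fin r) ℝ)
    (Y : Matrix (Fin n) (Fin r) ℝ) : ℝ :=
  ρ * ∑ i, G0 (3 * rowNorm X i ^ 2 / (2 * β1 ^ 2)) +
    ρ * ∑ j, G0 (3 * rowNorm Y j ^ 2 / (2 * β2 ^ 2)) +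
    ρ * G0 (3 * frob X ^ 2 / (2 * βT ^ 2)) +
    ρ * G0 (3 * frob Y ^ 2 / (2 * βT ^ 2))

/-- The regularized objective `F̃(X,Y)`. -/
def Ftilde {m n r : ℕ} (Ω : Finset (Fin m × Fin n)) (M : Matrix (Fin m) (Fin n) ℝ)
    (ρ β1 β2 βT : ℝ) (X : Matrix (Fin m) (Fin r) ℝ) (Y : Matrix (Fin n) (Fin r) ℝ) : ℝ :=
  (1 / 2) * frob (projOmega Ω (M - X * Yᵀ)) ^ 2 + Greg ρ β1 β2 βT X Y

/-- Gradient of the regularizer with respect to one of the factors. -/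
def gradG1 {m r : ℕ} (ρ β βT : ℝ) (X : Matrix (Fin m) (Fin r) ℝ) :
    Matrix (Fin m) (Fin r) ℝ :=
  (∑ i, (ρ * G0' (3 * rowNorm X i ^ 2 / (2 * β ^ 2)) * (3 / β ^ 2)) • rowMat X i) +
    (ρ * G0' (3 * frob X ^ 2 / (2 * βT ^ 2)) * (3 / βT ^ 2)) • X

/-- `∇_X F̃(X,Y)`. -/
def gradX {m n r : ℕ} (Ω : Finset (Fin m × Fin n)) (M : Matrix (Fin m) (Fin n) ℝ)
    (ρ β1 βT : ℝ) (X : Matrix (Fin m) (Fin r) ℝ) (Y : Matrix (Fin n) (Fin r) ℝ) :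
    Matrix (Fin m) (Fin r) ℝ :=
  projOmega Ω (X * Yᵀ - M) * Y + gradG1 ρ β1 βT X

/-- `∇_Y F̃(X,Y)`. -/
def gradY {m n r : ℕ} (Ω : Finset (Fin m × Fin n)) (M : Matrix (Fin m) (Fin n) ℝ)
    (ρ β2 βT : ℝ) (X : Matrix (Fin m) (Fin r) ℝ) (Y : Matrix (Fin n) (Fin r) ℝ) :
    Matrix (Fin n) (Fin r) ℝ :=
  (projOmega Ω (X * Yᵀ - M))ᵀ * X + gradG1 ρ β2 βT Y

/-- Membership in `K₁`. -/
def K1mem {m n r : ℕ} (β1 β2 : ℝ) (X : Matrix (Fin m) (Fin r) ℝ)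
    (Y : Matrix (Fin n) (Fin r) ℝ) : Prop :=
  (∀ i, rowNorm X i ≤ β1) ∧ ∀ j, rowNorm Y j ≤ β2

/-- Membership in `K₂`. -/
def K2mem {m n r : ℕ} (βT : ℝ) (X : Matrix (Fin m) (Fin r) ℝ)
    (Y : Matrix (Fin n) (Fin r) ℝ) : Prop :=
  frob X ≤ βT ∧ frob Y ≤ βT

/-- Membership in `K(t) = {(X,Y) : ‖M - XYᵀ‖_F ≤ t}`. -/
def Kmem {m n r : ℕ} (M : Matrix (Fin m) (Fin n) ℝ) (t : ℝ)
    (X : Matrix (Fin m) (Fin r) ℝ) (Y : Matrix (Fin n) (Fin r) ℝ) : Prop :=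
  frob (M - X * Yᵀ) ≤ t

theorem aux_choose (t : ℕ) : ∀ N S : ℕ, t ≤ S → S ≤ N →
    ((N - t).choose (S - t) : ℝ) ≤ ((S : ℝ) / N) ^ t * (N.choose S : ℝ) := by
  induction t with
  | zero => intro N S _ _; simp
  | succ t ih =>
    intro N S h1 h2
    obtain ⟨S, rfl⟩ : ∃ S', S = S' + 1 := ⟨S - 1, by omega⟩
    obtain ⟨N, rfl⟩ : ∃ N', N = N' + 1 := ⟨N - 1, by omega⟩
    have h := ih N S (by omega) (by omega)
    have e1 : N + 1 - (t + 1) = N - t := by omega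
    have e2 : S + 1 - (t + 1) = S - t := by omega
    rw [e1, e2]
    have h3 : (S : ℝ) / N ≤ ((S + 1 : ℕ) : ℝ) / ((N + 1 : ℕ) : ℝ) := by
      rcases Nat.eq_zero_or_pos N with rfl | hN
      · simp; positivity
      · have hN' : (0 : ℝ) < N := by exact_mod_cast hN
        have hSN : (S : ℝ) ≤ N := by exact_mod_cast (by omega : S ≤ N)
        push_cast
        rw [div_le_div_iff₀ hN' (by positivity)]
        nlinarith
    have h4 : (N.choose S : ℝ) = ((S + 1 : ℕ) : ℝ) / ((N + 1 : ℕ) : ℝ) * ((N + 1).choose (S + 1) : ℝ) := by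
      have := Nat.add_one_mul_choose_eq N S
      have h' : ((N : ℝ) + 1) * (N.choose S : ℝ) = ((N + 1).choose (S + 1) : ℝ) * ((S : ℝ) + 1) := by
        exact_mod_cast this
      push_cast
      field_simp
      linarith
    calc ((N - t).choose (S - t) : ℝ) ≤ ((S : ℝ) / N) ^ t * (N.choose S : ℝ) := h
      _ ≤ (((S + 1 : ℕ) : ℝ) / ((N + 1 : ℕ) : ℝ)) ^ t * (N.choose S : ℝ) := by
        gcongr
      _ = _ := by rw [h4]; ring

theorem aux_superset {α : Type*} [Fintype α] [DecidableEq α] (S : ℕ) (hS : S ≤ Fintype.card α)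
    (T : Finset α) :
    (((Finset.powersetCard S (Finset.univ : Finset α)).filter (fun Ω => T ⊆ Ω)).card : ℝ) ≤
      ((S : ℝ) / Fintype.card α) ^ T.card *
        ((Finset.powersetCard S (Finset.univ : Finset α)).card : ℝ) := by
  by_cases ht : T.card ≤ S
  · have h1 : ((Finset.powersetCard S (Finset.univ : Finset α)).filter (fun Ω => T ⊆ Ω)).card ≤
        (Finset.powersetCard (S - T.card) (Finset.univ \ T)).card := by
      apply Finset.card_le_card_of_injOn (fun Ω => Ω \ T)
      · intro Ω hΩ
        simp only [Finset.coe_filter, Finset.mem_powersetCard, Set.mem_ofPred_eq] at hΩ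
        simp only [Finset.mem_coe, Finset.mem_powersetCard]
        refine ⟨Finset.sdiff_subset_sdiff (Finset.subset_univ _) (Finset.Subset.refl _), ?_⟩
        rw [Finset.card_sdiff_of_subset hΩ.2, hΩ.1.2]
      · intro Ω hΩ Ω' hΩ' h
        simp only [Finset.coe_filter, Set.mem_ofPred_eq] at hΩ hΩ'
        have h' : Ω \ T = Ω' \ T := h
        rw [← Finset.sdiff_union_of_subset hΩ.2, ← Finset.sdiff_union_of_subset hΩ'.2, h']
    have h2 : (Finset.powersetCard (S - T.card) (Finset.univ \ T)).card =
        (Fintype.card α - T.card).choose (S - T.card) := by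
      rw [Finset.card_powersetCard, Finset.card_sdiff_of_subset (Finset.subset_univ _),
        Finset.card_univ]
    rw [h2] at h1
    rw [Finset.card_powersetCard, Finset.card_univ]
    exact le_trans (by exact_mod_cast h1) (aux_choose T.card _ _ ht hS)
  · have : (Finset.powersetCard S (Finset.univ : Finset α)).filter (fun Ω => T ⊆ Ω) = ∅ := by
      apply Finset.filter_eq_empty_iff.2
      intro Ω hΩ hT
      have := Finset.card_le_card hT
      rw [(Finset.mem_powersetCard.1 hΩ).2] at this
      exact ht this
    rw [this]
    simp only [Finset.card_empty, Nat.cast_zero]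
    positivity

theorem aux_mgf {α : Type*} [Fintype α] [DecidableEq α] (S : ℕ) (hS : S ≤ Fintype.card α)
    (B : Finset α) (z : ℝ) (hz : 0 ≤ z) :
    ∑ Ω ∈ Finset.powersetCard S (Finset.univ : Finset α), (z + 1) ^ (Ω ∩ B).card ≤
      ((Finset.powersetCard S (Finset.univ : Finset α)).card : ℝ) *
        Real.exp (z * ((S : ℝ) / Fintype.card α) * B.card) := by
  set p : ℝ := (S : ℝ) / Fintype.card α with hp
  have hp0 : 0 ≤ p := by positivity
  have h1 : ∀ Ω : Finset α, (z + 1) ^ (Ω ∩ B).card =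
      ∑ T ∈ B.powerset, if T ⊆ Ω then z ^ T.card else 0 := by
    intro Ω
    rw [← Finset.sum_pow_mul_eq_add_pow, ← Finset.sum_filter]
    apply Finset.sum_congr
    · ext T
      simp only [Finset.mem_powerset, Finset.mem_filter, Finset.subset_inter_iff]
      tauto
    · intros; simp
  calc _ = ∑ T ∈ B.powerset, ∑ Ω ∈ Finset.powersetCard S (Finset.univ : Finset α),
        (if T ⊆ Ω then z ^ T.card else 0) := by
        rw [Finset.sum_comm]
        exact Finset.sum_congr rfl (fun Ω _ => h1 Ω)
    _ = ∑ T ∈ B.powerset, (((Finset.powersetCard S (Finset.univ : Finset α)).filter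
          (fun Ω => T ⊆ Ω)).card : ℝ) * z ^ T.card := by
        apply Finset.sum_congr rfl
        intro T _
        rw [← Finset.sum_filter, Finset.sum_const, nsmul_eq_mul]
    _ ≤ ∑ T ∈ B.powerset, (p ^ T.card *
        ((Finset.powersetCard S (Finset.univ : Finset α)).card : ℝ)) * z ^ T.card := by
        apply Finset.sum_le_sum
        intro T _
        exact mul_le_mul_of_nonneg_right (aux_superset S hS T) (by positivity)
    _ = ((Finset.powersetCard S (Finset.univ : Finset α)).card : ℝ) * (z * p + 1) ^ B.card := by
        rw [← Finset.sum_pow_mul_eq_add_pow, Finset.mul_sum]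
        apply Finset.sum_congr rfl
        intro T _
        rw [mul_pow]; simp; ring
    _ ≤ _ := by
        apply mul_le_mul_of_nonneg_left _ (by positivity)
        rw [mul_comm (z * p), Real.exp_nat_mul]
        exact pow_le_pow_left₀ (by positivity) (Real.add_one_le_exp _) _

theorem aux_tail {α : Type*} [Fintype α] [DecidableEq α] (S : ℕ) (hS : S ≤ Fintype.card α)
    (B : Finset α) (θ τ : ℝ) (hθ : 1 ≤ θ) :
    (((Finset.powersetCard S (Finset.univ : Finset α)).filter
      (fun Ω => τ < ((Ω ∩ B).card : ℝ))).card : ℝ) ≤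
      ((Finset.powersetCard S (Finset.univ : Finset α)).card : ℝ) *
        Real.exp ((θ - 1) * ((S : ℝ) / Fintype.card α) * B.card - τ * Real.log θ) := by
  have h := aux_mgf S hS B (θ - 1) (by linarith)
  have h2 : (((Finset.powersetCard S (Finset.univ : Finset α)).filter
      (fun Ω => τ < ((Ω ∩ B).card : ℝ))).card : ℝ) * Real.exp (τ * Real.log θ) ≤
      ∑ Ω ∈ Finset.powersetCard S (Finset.univ : Finset α), (θ - 1 + 1) ^ (Ω ∩ B).card := by
    rw [← nsmul_eq_mul, ← Finset.sum_const]
    refine le_trans (Finset.sum_le_sum (g := fun Ω => (θ - 1 + 1) ^ (Ω ∩ B).card) ?_) ?_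
    · intro Ω hΩ
      have := (Finset.mem_filter.1 hΩ).2
      have hθ0 : 0 < θ := by linarith
      have e : (θ - 1 + 1) ^ (Ω ∩ B).card = Real.exp ((Ω ∩ B).card * Real.log θ) := by
        rw [Real.exp_nat_mul, Real.exp_log hθ0]; ring
      rw [e]
      apply Real.exp_le_exp.2
      exact mul_le_mul_of_nonneg_right this.le (Real.log_nonneg hθ)
    · apply Finset.sum_le_sum_of_subset_of_nonneg (Finset.filter_subset _ _)
      intro Ω _ _
      have : 0 ≤ θ - 1 + 1 := by linarith
      positivity
  rw [Real.exp_sub, ← mul_div_assoc, le_div_iff₀ (Real.exp_pos _)]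
  linarith

theorem aux_Lbound (N a k0 τ θ : ℝ) (ha : 1 ≤ a) (haN : a ≤ N) (hk : 0 ≤ k0) (hτ : k0 ≤ τ)
    (hθ0 : 0 < θ) (hθ : 2 ≤ Real.log θ) (hk2 : 135 * a ≤ k0)
    (h : 1000 * N * a ≤ k0 ^ 2 ∨ 1000 * (N / a) ≤ θ ^ 2) :
    7 * (a * (1 + Real.log (N / a))) ≤ 1 / 4 * (τ * Real.log θ) := by
  have ha0 : 0 < a := by linarith
  have hNa : 1 ≤ N / a := by rw [le_div_iff₀ ha0]; linarith
  rcases h with h | h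
  · set z := Real.sqrt (N / a) with hz
    have hz2 : z ^ 2 = N / a := Real.sq_sqrt (by linarith)
    have hz1 : 1 ≤ z := by rw [hz]; exact Real.one_le_sqrt.2 hNa
    have hlog : Real.log (N / a) = 2 * Real.log z := by
      rw [← hz2, Real.log_pow]; norm_num
    have hlz : Real.log z ≤ z - 1 := Real.log_le_sub_one_of_pos (by linarith)
    have hN : N = z ^ 2 * a := by rw [hz2]; field_simp
    have hk3 : 31 * (a * z) ≤ k0 := by
      apply le_of_sq_le_sq _ hk
      rw [hN] at h
      nlinarith [sq_nonneg (a * z)]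
    have h1 : a * (1 + Real.log (N / a)) ≤ 2 * (a * z) := by
      rw [hlog]
      nlinarith
    have h2 : τ * 2 ≤ τ * Real.log θ := mul_le_mul_of_nonneg_left hθ (by linarith)
    have h3 : 0 ≤ a * z := by positivity
    linarith
  · have h1 : Real.log (1000 * (N / a)) ≤ 2 * Real.log θ := by
      have := Real.log_le_log (by positivity) h
      rw [Real.log_pow] at this
      exact_mod_cast this
    rw [Real.log_mul (by norm_num) (by positivity)] at h1
    have h2 : (1 : ℝ) ≤ Real.log 1000 := by
      rw [Real.le_log_iff_exp_le (by norm_num)]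
      linarith [Real.exp_one_lt_d9]
    have h3 : 0 ≤ Real.log (N / a) := Real.log_nonneg hNa
    have h4 : (135 * a) * ((1 + Real.log (N / a)) / 2) ≤ τ * Real.log θ := by
      apply mul_le_mul <;> linarith
    nlinarith [mul_nonneg ha0.le h3]

theorem aux_choose_exp (N a : ℕ) (ha : 1 ≤ a) (haN : a ≤ N) :
    (N.choose a : ℝ) ≤ Real.exp (a * (1 + Real.log ((N : ℝ) / a))) := by
  have ha0 : (0 : ℝ) < a := by exact_mod_cast ha
  have hN0 : (0 : ℝ) < N := by exact_mod_cast (by omega : 0 < N)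
  have h1 : (N.choose a : ℝ) ≤ (N : ℝ) ^ a / (a.factorial : ℝ) := Nat.choose_le_pow_div a N
  have h2 : (a : ℝ) ^ a / (a.factorial : ℝ) ≤ Real.exp a :=
    Real.pow_div_factorial_le_exp a ha0.le a
  have h3 : Real.exp (a * (1 + Real.log ((N : ℝ) / a))) = Real.exp a * ((N : ℝ) / a) ^ a := by
    rw [mul_add, mul_one, Real.exp_add, Real.exp_nat_mul (Real.log _),
      Real.exp_log (by positivity)]
  rw [h3]
  calc (N.choose a : ℝ) ≤ (N : ℝ) ^ a / (a.factorial : ℝ) := h1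
    _ = (a : ℝ) ^ a / (a.factorial : ℝ) * ((N : ℝ) / a) ^ a := by
      rw [div_pow]; field_simp
    _ ≤ _ := by gcongr

theorem aux_Lmono (N a : ℕ) (ha : 1 ≤ a) (haN : a ≤ N) :
    1 + Real.log N ≤ a * (1 + Real.log ((N : ℝ) / a)) := by
  have ha1 : (1 : ℝ) ≤ a := by exact_mod_cast ha
  have hN : (a : ℝ) ≤ N := by exact_mod_cast haN
  rw [Real.log_div (by linarith) (by linarith)]
  have h1 : Real.log a ≤ Real.log N := Real.log_le_log (by linarith) hN
  have h2 : Real.log a ≤ a - 1 := Real.log_le_sub_one_of_pos (by linarith)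
  nlinarith

theorem aux_sum (N : ℕ) (hN : 1 ≤ N) :
    ∑ I : Finset (Fin N), (if I.card = 0 then 0 else
      Real.exp (-(7 * (I.card * (1 + Real.log ((N : ℝ) / I.card)))))) ≤ 1 / (4 * (N : ℝ) ^ 4) := by
  have hN0 : (1 : ℝ) ≤ N := by exact_mod_cast hN
  have h := Finset.sum_powerset_apply_card (fun a : ℕ => (if a = 0 then (0 : ℝ) else
      Real.exp (-(7 * (a * (1 + Real.log ((N : ℝ) / a))))))) (x := (Finset.univ : Finset (Fin N)))
  rw [Finset.powerset_univ] at h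
  rw [h, Finset.card_univ, Fintype.card_fin, Finset.sum_range_succ']
  have h2 : ∀ a ∈ Finset.range N, (N.choose (a + 1)) • (if a + 1 = 0 then (0 : ℝ) else
      Real.exp (-(7 * ((a + 1 : ℕ) * (1 + Real.log ((N : ℝ) / (a + 1 : ℕ))))))) ≤
      Real.exp (-(6 * (1 + Real.log N))) := by
    intro a ha
    have haN : a + 1 ≤ N := by have := Finset.mem_range.1 ha; omega
    rw [if_neg (by omega), nsmul_eq_mul]
    have e1 := aux_choose_exp N (a + 1) (by omega) haN
    have e2 := aux_Lmono N (a + 1) (by omega) haN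
    refine le_trans (mul_le_mul_of_nonneg_right e1 (Real.exp_pos _).le) ?_
    rw [← Real.exp_add]
    apply Real.exp_le_exp.2
    linarith
  have h3 := Finset.sum_le_sum h2
  rw [Finset.sum_const, Finset.card_range, nsmul_eq_mul] at h3
  have h4 : Real.exp (-(6 * (1 + Real.log N))) = Real.exp (-6) * ((N : ℝ) ^ 6)⁻¹ := by
    rw [show -(6 * (1 + Real.log N)) = -6 + -(((6 : ℕ) : ℝ) * Real.log N) by push_cast; ring,
      Real.exp_add, Real.exp_neg (_ * _), Real.exp_nat_mul, Real.exp_log (by linarith)]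
  have h5 : Real.exp (-6) ≤ 1 / 4 := by
    rw [Real.exp_neg, inv_eq_one_div]
    apply one_div_le_one_div_of_le (by norm_num)
    have := Real.add_one_le_exp (6 : ℝ)
    linarith
  rw [h4] at h3
  simp only [if_true, smul_zero, add_zero]
  refine le_trans h3 ?_
  calc (N : ℝ) * (Real.exp (-6) * ((N : ℝ) ^ 6)⁻¹) = Real.exp (-6) * ((N : ℝ) ^ 5)⁻¹ := by
        field_simp
    _ ≤ 1 / 4 * ((N : ℝ) ^ 4)⁻¹ := by
        apply mul_le_mul h5 _ (by positivity) (by norm_num)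
        apply inv_anti₀ (by positivity)
        exact pow_le_pow_right₀ hN0 (by norm_num)
    _ = _ := by field_simp

theorem aux_exp2 : (7 : ℝ) < Real.exp 2 ∧ Real.exp 2 < 7.4 := by
  have h : Real.exp 2 = Real.exp 1 * Real.exp 1 := by rw [← Real.exp_add]; norm_num
  rw [h]
  constructor <;> nlinarith [Real.exp_one_gt_d9, Real.exp_one_lt_d9]

theorem aux_rare (p a b k0 : ℝ) (m n : ℝ) (ha : 1 ≤ a) (hb : 1 ≤ b) (ham : a ≤ m) (hbn : b ≤ n)
    (hnm : n ≤ m) (hp : 0 < p) (hk0 : 0 < k0) (hk : k0 ^ 2 = 1000 * p * m * (a * b))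
    (hr : k0 < a * (Real.exp 2 * p * n)) (hc : k0 < b * (Real.exp 2 * p * m)) :
    ∃ θ : ℝ, 1 ≤ θ ∧
    (θ - 1) * p * (a * b) - (Real.exp 2 * p * (a * b) + k0) * Real.log θ ≤
      -(7 * (a * (1 + Real.log (m / a)))) + -(7 * (b * (1 + Real.log (n / b)))) := by
  obtain ⟨he1, he2⟩ := aux_exp2
  have hab : 0 < a * b := by positivity
  have hpab : 0 < p * (a * b) := by positivity
  have hm : 0 < m := by linarith
  set τ := Real.exp 2 * p * (a * b) + k0 with hτ
  have hθdef : τ / (p * (a * b)) = Real.exp 2 + k0 / (p * (a * b)) := by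
    rw [hτ]; field_simp
  set θ := τ / (p * (a * b)) with hθ
  have hq : 0 < k0 / (p * (a * b)) := by positivity
  have hθe : Real.exp 2 ≤ θ := by linarith
  have hθ0 : 0 < θ := by linarith
  have hlog : 2 ≤ Real.log θ := by
    rw [Real.le_log_iff_exp_le hθ0]; exact hθe
  have hτk : k0 ≤ τ := by
    have : 0 < Real.exp 2 * p * (a * b) := by positivity
    linarith
  have hθτ : θ * (p * (a * b)) = τ := by rw [hθ]; field_simp
  have hka : 135 * a ≤ k0 := by
    have : 1000 * a * k0 ≤ (Real.exp 2 * k0) * k0 := by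
      have e : (Real.exp 2 * k0) * k0 = 1000 * a * (b * (Real.exp 2 * p * m)) := by
        rw [mul_assoc, ← sq, hk]; ring
      rw [e]
      exact mul_le_mul_of_nonneg_left hc.le (by positivity)
    have h2 := le_of_mul_le_mul_right this hk0
    nlinarith
  have hkb : 135 * b ≤ k0 := by
    have hr' : k0 ≤ a * (Real.exp 2 * p * m) := by
      refine hr.le.trans ?_
      gcongr
    have : 1000 * b * k0 ≤ (Real.exp 2 * k0) * k0 := by
      have e : (Real.exp 2 * k0) * k0 = 1000 * b * (a * (Real.exp 2 * p * m)) := by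
        rw [mul_assoc, ← sq, hk]; ring
      rw [e]
      exact mul_le_mul_of_nonneg_left hr' (by positivity)
    have h2 := le_of_mul_le_mul_right this hk0
    nlinarith
  have hθ2 : 1000 * m / (p * (a * b)) ≤ θ ^ 2 := by
    have : (k0 / (p * (a * b))) ^ 2 ≤ θ ^ 2 := by
      apply pow_le_pow_left₀ hq.le
      linarith [Real.exp_pos 2]
    refine le_trans (le_of_eq ?_) this
    rw [div_pow, hk]; field_simp
  have A := aux_Lbound m a k0 τ θ ha ham hk0.le hτk hθ0 hlog hka (by
    rcases le_total 1 (p * b) with h | h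
    · left
      rw [hk]
      have : 0 < m * a := by positivity
      nlinarith
    · right
      refine le_trans ?_ hθ2
      rw [mul_div_assoc]
      apply mul_le_mul_of_nonneg_left _ (by norm_num)
      apply div_le_div_of_nonneg_left hm.le hpab
      nlinarith)
  have Bb := aux_Lbound n b k0 τ θ hb hbn hk0.le hτk hθ0 hlog hkb (by
    rcases le_total 1 (p * a) with h | h
    · left
      rw [hk]
      have : 0 < m * b := by positivity
      nlinarith
    · right
      refine le_trans ?_ hθ2
      rw [mul_div_assoc]
      apply mul_le_mul_of_nonneg_left _ (by norm_num)
      apply div_le_div₀ hm.le hnm hpab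
      nlinarith)
  refine ⟨θ, by linarith, ?_⟩
  have h2 : τ * 2 ≤ τ * Real.log θ := mul_le_mul_of_nonneg_left hlog (by linarith)
  have h3 : (θ - 1) * p * (a * b) = τ - p * (a * b) := by rw [← hθτ]; ring
  rw [h3]
  linarith

theorem aux_prob (m n S : ℕ) (hn : 1 ≤ n) (hnm : n ≤ m) (hS : S ≤ m * n) (p : ℝ)
    (hp : p = (S : ℝ) / (m * n)) (h1 : 10 * Real.sqrt ((m : ℝ) / n) ≤ p * n)
    (h2 : 10 * Real.log n ≤ p * n) :
    (1 - 1 / (2 * (n : ℝ) ^ 4)) *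
      ((Finset.powersetCard S (Finset.univ : Finset (Fin m × Fin n))).card : ℝ) ≤
    (((Finset.powersetCard S (Finset.univ : Finset (Fin m × Fin n))).filter
      (fun Ω => ∀ (I : Finset (Fin m)) (J : Finset (Fin n)),
        ((Ω ∩ (I ×ˢ J)).card : ℝ) ≤ Real.exp 2 * p * ((I.card : ℝ) * J.card) +
          Real.sqrt (1000 * p * m * ((I.card : ℝ) * J.card)))).card : ℝ) := by
  obtain ⟨he1, he2⟩ := aux_exp2
  have hn1 : (1 : ℝ) ≤ n := by exact_mod_cast hn
  have hnm' : (n : ℝ) ≤ m := by exact_mod_cast hnm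
  have hm1 : (1 : ℝ) ≤ m := by linarith
  have hα : 1 ≤ (m : ℝ) / n := by rw [le_div_iff₀ (by linarith)]; linarith
  have hsα : 1 ≤ Real.sqrt ((m : ℝ) / n) := Real.one_le_sqrt.2 hα
  have hpn : 10 ≤ p * n := by linarith
  have hp0 : 0 < p := by
    by_contra h
    have : p * n ≤ 0 := mul_nonpos_of_nonpos_of_nonneg (not_lt.1 h) (by linarith)
    linarith
  have hcard : Fintype.card (Fin m × Fin n) = m * n := by simp
  have hS' : S ≤ Fintype.card (Fin m × Fin n) := by rw [hcard]; exact hS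
  have hpc : (S : ℝ) / (Fintype.card (Fin m × Fin n) : ℕ) = p := by
    rw [hcard, hp]; push_cast; rfl
  set P := Finset.powersetCard S (Finset.univ : Finset (Fin m × Fin n)) with hP
  set Pc : ℝ := (P.card : ℝ) with hPc
  have hPc0 : 0 ≤ Pc := by positivity
  set τ : Finset (Fin m) → Finset (Fin n) → ℝ := fun I J =>
    Real.exp 2 * p * ((I.card : ℝ) * J.card) +
          Real.sqrt (1000 * p * m * ((I.card : ℝ) * J.card)) with hτ
  -- tail in a form for rectangles
  have tail : ∀ (I : Finset (Fin m)) (J : Finset (Fin n)) (θ t : ℝ), 1 ≤ θ →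
      ((P.filter (fun Ω => t < ((Ω ∩ (I ×ˢ J)).card : ℝ))).card : ℝ) ≤
      Pc * Real.exp ((θ - 1) * p * ((I.card : ℝ) * J.card) - t * Real.log θ) := by
    intro I J θ t hθ
    have := aux_tail S hS' (I ×ˢ J) θ t hθ
    rw [hpc, Finset.card_product] at this
    push_cast at this
    exact this
  -- logs
  have hlogm : Real.log m ≤ Real.log n + 2 * Real.sqrt ((m : ℝ) / n) := by
    have e : (m : ℝ) = n * (Real.sqrt ((m : ℝ) / n)) ^ 2 := by
      rw [Real.sq_sqrt (by linarith)]; field_simp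
    have e2 : Real.log m = Real.log n + 2 * Real.log (Real.sqrt ((m : ℝ) / n)) := by
      conv_lhs => rw [e]
      rw [Real.log_mul (by linarith) (by positivity), Real.log_pow]; norm_num
    have e3 := Real.log_le_sub_one_of_pos (show 0 < Real.sqrt ((m : ℝ) / n) by linarith)
    linarith
  have hlog8 : Real.log 8 ≤ 7 := by
    have := Real.log_le_sub_one_of_pos (show (0 : ℝ) < 8 by norm_num)
    linarith
  have hmexp : (m : ℝ) * Real.exp (-(Real.exp 2 * (p * n))) ≤ 1 / (8 * (n : ℝ) ^ 4) := by
    have e1 : (m : ℝ) = Real.exp (Real.log m) := (Real.exp_log (by linarith)).symm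
    have e2 : 1 / (8 * (n : ℝ) ^ 4) = Real.exp (-(Real.log 8 + ((4 : ℕ) : ℝ) * Real.log n)) := by
      rw [Real.exp_neg, Real.exp_add, Real.exp_nat_mul, Real.exp_log (by norm_num),
        Real.exp_log (by linarith), one_div]
    rw [e2]
    conv_lhs => rw [e1]
    rw [← Real.exp_add]
    apply Real.exp_le_exp.2
    have : 7 * (p * n) ≤ Real.exp 2 * (p * n) :=
      mul_le_mul_of_nonneg_right he1.le (by linarith)
    push_cast
    linarith
  set R : Fin m → Finset (Finset (Fin m × Fin n)) := fun i =>
    P.filter (fun Ω => Real.exp 2 * p * n < ((Ω ∩ (({i} : Finset (Fin m)) ×ˢ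
      (Finset.univ : Finset (Fin n)))).card : ℝ)) with hR
  set Cc : Fin n → Finset (Finset (Fin m × Fin n)) := fun j =>
    P.filter (fun Ω => Real.exp 2 * p * m < ((Ω ∩ ((Finset.univ : Finset (Fin m)) ×ˢ
      ({j} : Finset (Fin n)))).card : ℝ)) with hCc
  set E : Finset (Fin m) × Finset (Fin n) → Finset (Finset (Fin m × Fin n)) := fun q =>
    P.filter (fun Ω => (τ q.1 q.2 < ((Ω ∩ (q.1 ×ˢ q.2)).card : ℝ)) ∧
      Real.sqrt (1000 * p * m * ((q.1.card : ℝ) * q.2.card)) < q.1.card * (Real.exp 2 * p * n) ∧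
      Real.sqrt (1000 * p * m * ((q.1.card : ℝ) * q.2.card)) < q.2.card * (Real.exp 2 * p * m))
    with hE
  have hRb : ∑ i, ((R i).card : ℝ) ≤ Pc * (1 / (8 * (n : ℝ) ^ 4)) := by
    have : ∀ i ∈ (Finset.univ : Finset (Fin m)),
        ((R i).card : ℝ) ≤ Pc * Real.exp (-(Real.exp 2 * (p * n))) := by
      intro i _
      refine (tail {i} Finset.univ (Real.exp 2) (Real.exp 2 * p * n) (by linarith)).trans ?_
      apply mul_le_mul_of_nonneg_left _ hPc0
      apply Real.exp_le_exp.2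
      rw [Real.log_exp]
      simp only [Finset.card_singleton, Finset.card_univ, Fintype.card_fin, Nat.cast_one]
      nlinarith
    refine (Finset.sum_le_sum this).trans ?_
    rw [Finset.sum_const, Finset.card_univ, Fintype.card_fin, nsmul_eq_mul]
    calc _ = Pc * ((m : ℝ) * Real.exp (-(Real.exp 2 * (p * n)))) := by ring
      _ ≤ _ := mul_le_mul_of_nonneg_left hmexp hPc0
  have hCb : ∑ j, ((Cc j).card : ℝ) ≤ Pc * (1 / (8 * (n : ℝ) ^ 4)) := by
    have : ∀ j ∈ (Finset.univ : Finset (Fin n)),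
        ((Cc j).card : ℝ) ≤ Pc * Real.exp (-(Real.exp 2 * (p * n))) := by
      intro j _
      refine (tail Finset.univ {j} (Real.exp 2) (Real.exp 2 * p * m) (by linarith)).trans ?_
      apply mul_le_mul_of_nonneg_left _ hPc0
      apply Real.exp_le_exp.2
      rw [Real.log_exp]
      simp only [Finset.card_singleton, Finset.card_univ, Fintype.card_fin, Nat.cast_one]
      have : p * n ≤ p * m := mul_le_mul_of_nonneg_left hnm' hp0.le
      nlinarith
    refine (Finset.sum_le_sum this).trans ?_
    rw [Finset.sum_const, Finset.card_univ, Fintype.card_fin, nsmul_eq_mul]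
    calc _ = Pc * ((n : ℝ) * Real.exp (-(Real.exp 2 * (p * n)))) := by ring
      _ ≤ Pc * ((m : ℝ) * Real.exp (-(Real.exp 2 * (p * n)))) := by gcongr
      _ ≤ _ := mul_le_mul_of_nonneg_left hmexp hPc0
  have hEb : ∑ q, ((E q).card : ℝ) ≤ Pc * (1 / (16 * (n : ℝ) ^ 4)) := by
    have key : ∀ q ∈ (Finset.univ : Finset (Finset (Fin m) × Finset (Fin n))),
        ((E q).card : ℝ) ≤ Pc * ((if q.1.card = 0 then 0 else
          Real.exp (-(7 * (q.1.card * (1 + Real.log ((m : ℝ) / q.1.card)))))) *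
          (if q.2.card = 0 then 0 else
          Real.exp (-(7 * (q.2.card * (1 + Real.log ((n : ℝ) / q.2.card))))))) := by
      rintro ⟨I, J⟩ _
      set k0 := Real.sqrt (1000 * p * m * ((I.card : ℝ) * J.card)) with hk0
      have hrhs : 0 ≤ Pc * ((if I.card = 0 then 0 else
          Real.exp (-(7 * (I.card * (1 + Real.log ((m : ℝ) / I.card)))))) *
          (if J.card = 0 then 0 else
          Real.exp (-(7 * (J.card * (1 + Real.log ((n : ℝ) / J.card))))))) := by
        split_ifs <;> positivity
      by_cases hreg : k0 < I.card * (Real.exp 2 * p * n) ∧ k0 < J.card * (Real.exp 2 * p * m)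
      · have hI : I.card ≠ 0 := by
          intro h
          have := hreg.1
          rw [h] at this
          simp only [Nat.cast_zero, zero_mul] at this
          exact absurd this (not_lt.2 (Real.sqrt_nonneg _))
        have hJ : J.card ≠ 0 := by
          intro h
          have := hreg.2
          rw [h] at this
          simp only [Nat.cast_zero, zero_mul] at this
          exact absurd this (not_lt.2 (Real.sqrt_nonneg _))
        have ha : (1 : ℝ) ≤ I.card := by exact_mod_cast Nat.one_le_iff_ne_zero.2 hI
        have hb : (1 : ℝ) ≤ J.card := by exact_mod_cast Nat.one_le_iff_ne_zero.2 hJ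
        have ham : (I.card : ℝ) ≤ m := by
          exact_mod_cast (by simpa using Finset.card_le_univ I : I.card ≤ m)
        have hbn : (J.card : ℝ) ≤ n := by
          exact_mod_cast (by simpa using Finset.card_le_univ J : J.card ≤ n)
        have hpos : 0 < 1000 * p * m * ((I.card : ℝ) * J.card) := by positivity
        obtain ⟨θ, hθ1, hθ2⟩ := aux_rare p I.card J.card k0 m n ha hb ham hbn hnm' hp0
          (Real.sqrt_pos.2 hpos) (Real.sq_sqrt hpos.le) hreg.1 hreg.2
        simp only [if_neg hI, if_neg hJ]
        rw [← Real.exp_add]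
        have hsub : ((E (I, J)).card : ℝ) ≤
            ((P.filter (fun Ω => τ I J < ((Ω ∩ (I ×ˢ J)).card : ℝ))).card : ℝ) := by
          exact_mod_cast Finset.card_le_card (by
            intro Ω hΩ
            rw [Finset.mem_filter] at hΩ ⊢
            exact ⟨hΩ.1, hΩ.2.1⟩)
        refine hsub.trans ((tail I J θ (τ I J) hθ1).trans ?_)
        exact mul_le_mul_of_nonneg_left (Real.exp_le_exp.2 hθ2) hPc0
      · have : E (I, J) = ∅ := by
          apply Finset.filter_eq_empty_iff.2
          intro Ω _ h
          exact hreg h.2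
        rw [this]
        simpa using hrhs
    refine (Finset.sum_le_sum key).trans ?_
    rw [← Finset.mul_sum]
    apply mul_le_mul_of_nonneg_left _ hPc0
    rw [Fintype.sum_prod_type]
    simp only
    rw [← Finset.sum_mul_sum]
    have s1 := aux_sum m (by omega)
    have s2 := aux_sum n hn
    have s3 : (1 : ℝ) / (4 * (m : ℝ) ^ 4) ≤ 1 / 4 := by
      apply one_div_le_one_div_of_le (by norm_num)
      have : 1 ≤ (m : ℝ) ^ 4 := one_le_pow₀ hm1
      linarith
    refine (mul_le_mul (s1.trans s3) s2 ?_ (by norm_num)).trans (le_of_eq ?_)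
    · apply Finset.sum_nonneg
      intro J _
      split_ifs <;> positivity
    · field_simp; norm_num
  set good : Finset (Fin m × Fin n) → Prop := fun Ω =>
    ∀ (I : Finset (Fin m)) (J : Finset (Fin n)), ((Ω ∩ (I ×ˢ J)).card : ℝ) ≤ τ I J with hgood
  have hsplit : ((P.filter good).card : ℝ) + ((P.filter (fun Ω => ¬ good Ω)).card : ℝ) = Pc := by
    rw [hPc]
    exact_mod_cast Finset.card_filter_add_card_filter_not good
  have hbad : (P.filter (fun Ω => ¬ good Ω)) ⊆
      (Finset.univ.biUnion R ∪ Finset.univ.biUnion Cc) ∪ Finset.univ.biUnion E := by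
    intro Ω hΩ
    rw [Finset.mem_filter] at hΩ
    obtain ⟨hΩP, hng⟩ := hΩ
    by_contra hnot
    simp only [Finset.mem_union, Finset.mem_biUnion, Finset.mem_univ, true_and, not_or,
      not_exists] at hnot
    obtain ⟨⟨hr, hc⟩, hee⟩ := hnot
    apply hng
    intro I J
    by_contra hlt
    rw [not_le] at hlt
    have hnn : 0 ≤ Real.exp 2 * p * ((I.card : ℝ) * J.card) := by positivity
    have hr' : ((Ω ∩ (I ×ˢ J)).card : ℝ) ≤ I.card * (Real.exp 2 * p * n) := by
      have e : Ω ∩ (I ×ˢ J) ⊆ I.biUnion (fun i => Ω ∩ (({i} : Finset (Fin m)) ×ˢ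
          (Finset.univ : Finset (Fin n)))) := by
        rintro ⟨i, j⟩ h
        simp only [Finset.mem_inter, Finset.mem_product, Finset.mem_biUnion,
          Finset.mem_singleton, Finset.mem_univ, and_true] at h ⊢
        exact ⟨i, h.2.1, h.1, rfl⟩
      have e2 := (Finset.card_le_card e).trans Finset.card_biUnion_le
      have e3 : ((Ω ∩ (I ×ˢ J)).card : ℝ) ≤ ∑ i ∈ I, ((Ω ∩ (({i} : Finset (Fin m)) ×ˢ
          (Finset.univ : Finset (Fin n)))).card : ℝ) := by exact_mod_cast e2
      refine e3.trans ?_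
      rw [← nsmul_eq_mul]
      apply Finset.sum_le_card_nsmul
      intro i _
      by_contra h
      exact hr i (Finset.mem_filter.2 ⟨hΩP, not_le.1 h⟩)
    have hc' : ((Ω ∩ (I ×ˢ J)).card : ℝ) ≤ J.card * (Real.exp 2 * p * m) := by
      have e : Ω ∩ (I ×ˢ J) ⊆ J.biUnion (fun j => Ω ∩ ((Finset.univ : Finset (Fin m)) ×ˢ
          ({j} : Finset (Fin n)))) := by
        rintro ⟨i, j⟩ h
        simp only [Finset.mem_inter, Finset.mem_product, Finset.mem_biUnion,
          Finset.mem_singleton, Finset.mem_univ, true_and] at h ⊢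
        exact ⟨j, h.2.2, h.1, rfl⟩
      have e2 := (Finset.card_le_card e).trans Finset.card_biUnion_le
      have e3 : ((Ω ∩ (I ×ˢ J)).card : ℝ) ≤ ∑ j ∈ J, ((Ω ∩ ((Finset.univ : Finset (Fin m)) ×ˢ
          ({j} : Finset (Fin n)))).card : ℝ) := by exact_mod_cast e2
      refine e3.trans ?_
      rw [← nsmul_eq_mul]
      apply Finset.sum_le_card_nsmul
      intro j _
      by_contra h
      exact hc j (Finset.mem_filter.2 ⟨hΩP, not_le.1 h⟩)
    have hlt' : Real.exp 2 * p * ((I.card : ℝ) * J.card) +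
          Real.sqrt (1000 * p * m * ((I.card : ℝ) * J.card)) < ((Ω ∩ (I ×ˢ J)).card : ℝ) := hlt
    exact hee (I, J) (Finset.mem_filter.2 ⟨hΩP, hlt, by linarith, by linarith⟩)
  have hbadc : ((P.filter (fun Ω => ¬ good Ω)).card : ℝ) ≤
      ∑ i, ((R i).card : ℝ) + ∑ j, ((Cc j).card : ℝ) + ∑ q, ((E q).card : ℝ) := by
    have e := (Finset.card_le_card hbad).trans ((Finset.card_union_le _ _).trans
      (Nat.add_le_add ((Finset.card_union_le _ _).trans (Nat.add_le_add Finset.card_biUnion_le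
        Finset.card_biUnion_le)) Finset.card_biUnion_le))
    exact_mod_cast e
  have hfin : Pc * (1 / (8 * (n : ℝ) ^ 4)) + Pc * (1 / (8 * (n : ℝ) ^ 4)) +
      Pc * (1 / (16 * (n : ℝ) ^ 4)) ≤ 1 / (2 * (n : ℝ) ^ 4) * Pc := by
    have : 0 ≤ Pc * (1 / (n : ℝ) ^ 4) := by positivity
    have e : ∀ c : ℝ, 1 / (c * (n : ℝ) ^ 4) = 1 / c * (1 / (n : ℝ) ^ 4) := by
      intro c; rw [one_div_mul_one_div]
    rw [e, e, e]
    nlinarith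
  linarith

theorem aux_vertex {ι : Type*} [Fintype ι] (x c : ι → ℝ) (hx0 : ∀ i, 0 ≤ x i)
    (hx1 : ∀ i, x i ≤ 1) (b : ℝ) (h : ∀ I : Finset ι, ∑ i ∈ I, c i ≤ b) :
    ∑ i, x i * c i ≤ b := by
  refine le_trans ?_ (h (Finset.univ.filter (fun i => 0 < c i)))
  rw [Finset.sum_filter]
  apply Finset.sum_le_sum
  intro i _
  split_ifs with hc
  · nlinarith [hx1 i]
  · nlinarith [hx0 i]

theorem aux_bil {m n : ℕ} (Ω : Finset (Fin m × Fin n)) (c Q : ℝ) (hQ : 0 ≤ Q)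
    (hd : ∀ (I : Finset (Fin m)) (J : Finset (Fin n)),
      ((Ω ∩ (I ×ˢ J)).card : ℝ) ≤ c * ((I.card : ℝ) * J.card) +
        Real.sqrt (Q * ((I.card : ℝ) * J.card)))
    (x : Fin m → ℝ) (y : Fin n → ℝ) (hx0 : ∀ i, 0 ≤ x i) (hx1 : ∀ i, x i ≤ 1)
    (hy0 : ∀ i, 0 ≤ y i) (hy1 : ∀ i, y i ≤ 1) :
    ∑ i, ∑ j, (if (i, j) ∈ Ω then x i * y j else 0) ≤
      c * ((∑ i, x i) * ∑ j, y j) + Real.sqrt (Q * ((∑ i, x i) * ∑ j, y j)) := by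
  set s := ∑ i, x i with hs
  set t := ∑ j, y j with ht
  have hs0 : 0 ≤ s := Finset.sum_nonneg (fun i _ => hx0 i)
  have ht0 : 0 ≤ t := Finset.sum_nonneg (fun i _ => hy0 i)
  rcases hs0.eq_or_lt with h0 | hspos
  · have hx : ∀ i, x i = 0 := fun i =>
      (Finset.sum_eq_zero_iff_of_nonneg (fun i _ => hx0 i)).1 h0.symm i (Finset.mem_univ i)
    rw [← h0]; simp [hx]
  rcases ht0.eq_or_lt with h0 | htpos
  · have hy : ∀ i, y i = 0 := fun i =>
      (Finset.sum_eq_zero_iff_of_nonneg (fun i _ => hy0 i)).1 h0.symm i (Finset.mem_univ i)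
    rw [← h0]; simp [hy]
  set w : Fin m → Fin n → ℝ := fun i j => (if (i, j) ∈ Ω then 1 else 0) - c with hw
  set u := Real.sqrt s with hu
  set v := Real.sqrt t with hv
  have hu0 : 0 < u := Real.sqrt_pos.2 hspos
  have hv0 : 0 < v := Real.sqrt_pos.2 htpos
  have hu2 : u ^ 2 = s := Real.sq_sqrt hs0
  have hv2 : v ^ 2 = t := Real.sq_sqrt ht0
  set q := Real.sqrt Q with hq
  have hq0 : 0 ≤ q := Real.sqrt_nonneg _
  set l := q * (v / u) / 2 with hl
  set ν := q * (u / v) / 2 with hν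
  have hvert : ∀ (I : Finset (Fin m)) (J : Finset (Fin n)),
      ∑ i ∈ I, ∑ j ∈ J, w i j ≤ l * I.card + ν * J.card := by
    intro I J
    have e1 : ∑ i ∈ I, ∑ j ∈ J, w i j =
        ((Ω ∩ (I ×ˢ J)).card : ℝ) - c * ((I.card : ℝ) * J.card) := by
      simp only [hw, Finset.sum_sub_distrib, Finset.sum_const, nsmul_eq_mul]
      rw [← Finset.sum_product', Finset.sum_boole, Finset.inter_comm, ← Finset.filter_mem_eq_inter]
      simp only [Prod.mk.eta]
      ring
    rw [e1]
    have e2 : Real.sqrt (Q * ((I.card : ℝ) * J.card)) ≤ l * I.card + ν * J.card := by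
      rw [Real.sqrt_mul hQ, Real.sqrt_mul (by positivity)]
      set a := Real.sqrt (I.card : ℝ) with ha
      set b := Real.sqrt (J.card : ℝ) with hb
      have ha2 : (I.card : ℝ) = a ^ 2 := (Real.sq_sqrt (Nat.cast_nonneg _)).symm
      have hb2 : (J.card : ℝ) = b ^ 2 := (Real.sq_sqrt (Nat.cast_nonneg _)).symm
      rw [ha2, hb2]
      have : l * a ^ 2 + ν * b ^ 2 - q * (a * b) = q / (2 * (u * v)) * (v * a - u * b) ^ 2 := by
        rw [hl, hν]; field_simp; ring
      have h2 : 0 ≤ q / (2 * (u * v)) * (v * a - u * b) ^ 2 := by positivity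
      linarith
    have := hd I J
    linarith
  have step1 : ∀ J : Finset (Fin n), ∑ i, x i * (∑ j ∈ J, w i j - l) ≤ ν * J.card := by
    intro J
    apply aux_vertex x _ hx0 hx1
    intro I
    rw [Finset.sum_sub_distrib, Finset.sum_const, nsmul_eq_mul]
    linarith [hvert I J]
  have step2 : ∑ j, y j * (∑ i, x i * w i j - ν) ≤ l * s := by
    apply aux_vertex y _ hy0 hy1
    intro J
    have := step1 J
    simp only [mul_sub, Finset.sum_sub_distrib, ← Finset.sum_mul] at this
    rw [Finset.sum_sub_distrib, Finset.sum_const, nsmul_eq_mul, Finset.sum_comm]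
    simp only [← Finset.mul_sum]
    rw [← hs] at this
    linarith
  have step3 : ∑ j, y j * (∑ i, x i * w i j - ν) =
      ∑ i, ∑ j, (if (i, j) ∈ Ω then x i * y j else 0) - c * (s * t) - ν * t := by
    simp only [mul_sub, Finset.sum_sub_distrib, ← Finset.sum_mul]
    rw [← ht]
    have : ∑ j, y j * ∑ i, x i * w i j =
        ∑ i, ∑ j, (if (i, j) ∈ Ω then x i * y j else 0) - c * (s * t) := by
      rw [hs, ht, Finset.sum_mul_sum, Finset.mul_sum, ← Finset.sum_sub_distrib]
      simp only [Finset.mul_sum]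
      rw [Finset.sum_comm]
      apply Finset.sum_congr rfl
      intro i _
      rw [← Finset.sum_sub_distrib]
      apply Finset.sum_congr rfl
      intro j _
      simp only [hw]
      split_ifs <;> ring
    rw [this]; ring
  have e3 : Real.sqrt (Q * (s * t)) = l * s + ν * t := by
    rw [Real.sqrt_mul hQ, Real.sqrt_mul hs0, ← hu, ← hv, ← hq, hl, hν, ← hu2, ← hv2]
    field_simp; norm_num
  rw [e3]
  linarith

theorem aux_bil' {m n : ℕ} (Ω : Finset (Fin m × Fin n)) (c Q : ℝ) (hQ : 0 ≤ Q)
    (hd : ∀ (I : Finset (Fin m)) (J : Finset (Fin n)),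
      ((Ω ∩ (I ×ˢ J)).card : ℝ) ≤ c * ((I.card : ℝ) * J.card) +
        Real.sqrt (Q * ((I.card : ℝ) * J.card)))
    (x : Fin m → ℝ) (y : Fin n → ℝ) (a b : ℝ) (ha : 0 < a) (hb : 0 < b)
    (hx0 : ∀ i, 0 ≤ x i) (hx1 : ∀ i, x i ≤ a)
    (hy0 : ∀ i, 0 ≤ y i) (hy1 : ∀ i, y i ≤ b) :
    ∑ i, ∑ j, (if (i, j) ∈ Ω then x i * y j else 0) ≤
      c * ((∑ i, x i) * ∑ j, y j) + Real.sqrt (Q * (a * b) * ((∑ i, x i) * ∑ j, y j)) := by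
  have h := aux_bil Ω c Q hQ hd (fun i => x i / a) (fun j => y j / b)
    (fun i => div_nonneg (hx0 i) ha.le) (fun i => (div_le_one ha).2 (hx1 i))
    (fun i => div_nonneg (hy0 i) hb.le) (fun i => (div_le_one hb).2 (hy1 i))
  simp only [← Finset.sum_div] at h
  set s := ∑ i, x i
  set t := ∑ j, y j
  have e1 : ∑ i, ∑ j, (if (i, j) ∈ Ω then x i * y j else 0) =
      (a * b) * ∑ i, ∑ j, (if (i, j) ∈ Ω then x i / a * (y j / b) else 0) := by
    simp only [Finset.mul_sum]
    refine Finset.sum_congr rfl fun i _ => Finset.sum_congr rfl fun j _ => ?_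
    split_ifs
    · field_simp
    · simp
  have e2 : Real.sqrt (Q * (a * b) * (s * t)) =
      (a * b) * Real.sqrt (Q * (s / a * (t / b))) := by
    have e : Q * (a * b) * (s * t) = (a * b) ^ 2 * (Q * (s / a * (t / b))) := by field_simp
    rw [e, Real.sqrt_mul (by positivity), Real.sqrt_sq (by positivity)]
  rw [e1, e2]
  calc _ ≤ (a * b) * _ := mul_le_mul_of_nonneg_left h (by positivity)
    _ = _ := by field_simp

section Frob
attribute [local instance] Matrix.frobeniusNormedAddCommGroup

theorem frob_eq {m n : ℕ} (A : Matrix (Fin m) (Fin n) ℝ) : frob A = ‖A‖ := by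
  rw [Matrix.frobenius_norm_def, frob, Real.sqrt_eq_rpow]
  simp

theorem frob_add {m n : ℕ} (A B : Matrix (Fin m) (Fin n) ℝ) :
    frob (A + B) ≤ frob A + frob B := by
  simp only [frob_eq]; exact norm_add_le A B

theorem frob_sub {m n : ℕ} (A B : Matrix (Fin m) (Fin n) ℝ) :
    frob (A - B) ≤ frob A + frob B := by
  simp only [frob_eq]; exact norm_sub_le A B

theorem frob_neg {m n : ℕ} (A : Matrix (Fin m) (Fin n) ℝ) : frob (-A) = frob A := by
  simp only [frob_eq]; exact norm_neg A

theorem frob_mul {m n k : ℕ} (A : Matrix (Fin m) (Fin n) ℝ) (B : Matrix (Fin n) (Fin k) ℝ) :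
    frob (A * B) ≤ frob A * frob B := by
  simp only [frob_eq]; exact Matrix.frobenius_norm_mul A B

theorem frob_tr {m n : ℕ} (A : Matrix (Fin m) (Fin n) ℝ) : frob Aᵀ = frob A := by
  simp only [frob_eq]; exact Matrix.frobenius_norm_transpose A

theorem frob_eq_zero {m n : ℕ} (A : Matrix (Fin m) (Fin n) ℝ) (h : frob A = 0) : A = 0 := by
  rw [frob_eq] at h; exact norm_eq_zero.1 h

end Frob

theorem frob_nn {m n : ℕ} (A : Matrix (Fin m) (Fin n) ℝ) : 0 ≤ frob A := Real.sqrt_nonneg _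

theorem frob_sq {m n : ℕ} (A : Matrix (Fin m) (Fin n) ℝ) :
    frob A ^ 2 = ∑ i, ∑ j, A i j ^ 2 := Real.sq_sqrt (by positivity)

theorem rowNorm_sq {m n : ℕ} (A : Matrix (Fin m) (Fin n) ℝ) (i : Fin m) :
    rowNorm A i ^ 2 = ∑ j, A i j ^ 2 := Real.sq_sqrt (by positivity)

theorem frob_sq_tr {m n : ℕ} (A : Matrix (Fin m) (Fin n) ℝ) :
    frob A ^ 2 = (Aᵀ * A).trace := by
  rw [frob_sq, Finset.sum_comm]
  simp only [Matrix.trace, Matrix.diag, Matrix.mul_apply, Matrix.transpose_apply, sq]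

theorem frob_pyth {m n r : ℕ} (Q : Matrix (Fin m) (Fin r) ℝ) (hQ : Qᵀ * Q = 1)
    (W : Matrix (Fin m) (Fin n) ℝ) :
    frob W ^ 2 = frob (Qᵀ * W) ^ 2 + frob (W - Q * (Qᵀ * W)) ^ 2 := by
  simp only [frob_sq_tr, ← Matrix.trace_add]
  congr 1
  simp only [Matrix.transpose_mul, Matrix.transpose_sub, Matrix.transpose_transpose,
    Matrix.sub_mul, Matrix.mul_sub]
  have e : Wᵀ * Q * Qᵀ * (Q * (Qᵀ * W)) = Wᵀ * Q * (Qᵀ * W) := by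
    rw [Matrix.mul_assoc (Wᵀ * Q), ← Matrix.mul_assoc Qᵀ Q, hQ, Matrix.one_mul]
  rw [e]
  simp only [Matrix.mul_assoc]
  abel

theorem frob_contr {m n r : ℕ} (Q : Matrix (Fin m) (Fin r) ℝ) (hQ : Qᵀ * Q = 1)
    (W : Matrix (Fin m) (Fin n) ℝ) : frob (Qᵀ * W) ≤ frob W := by
  apply le_of_sq_le_sq _ (frob_nn _)
  rw [frob_pyth Q hQ W]
  nlinarith [sq_nonneg (frob (W - Q * (Qᵀ * W)))]

theorem frob_contr2 {m n r : ℕ} (Q : Matrix (Fin m) (Fin r) ℝ) (hQ : Qᵀ * Q = 1)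
    (W : Matrix (Fin m) (Fin n) ℝ) : frob (W - Q * (Qᵀ * W)) ≤ frob W := by
  apply le_of_sq_le_sq _ (frob_nn _)
  rw [frob_pyth Q hQ W]
  nlinarith [sq_nonneg (frob (Qᵀ * W))]

theorem frob_contr3 {m n r : ℕ} (Q : Matrix (Fin m) (Fin r) ℝ) (hQ : Qᵀ * Q = 1)
    (W : Matrix (Fin n) (Fin m) ℝ) : frob (W * Q) ≤ frob W := by
  rw [← frob_tr (W * Q), ← frob_tr W, Matrix.transpose_mul]
  exact frob_contr Q hQ _

theorem row_mul {m r k : ℕ} (A : Matrix (Fin m) (Fin r) ℝ) (B : Matrix (Fin r) (Fin k) ℝ)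
    (i : Fin m) : rowNorm (A * B) i ^ 2 ≤ (∑ k, A i k ^ 2) * frob B ^ 2 := by
  rw [rowNorm_sq, frob_sq, Finset.sum_comm, Finset.mul_sum]
  apply Finset.sum_le_sum
  intro j _
  rw [Matrix.mul_apply]
  exact Finset.sum_mul_sq_le_sq_mul_sq _ _ _

theorem aux_inv {r : ℕ} (σ : Fin r → ℝ) (N : Matrix (Fin r) (Fin r) ℝ) (d s : ℝ) (hs : 0 < s)
    (hσ : ∀ k, s ≤ σ k) (hN : frob (N - Matrix.diagonal σ) ≤ d) {k : ℕ}
    (Z : Matrix (Fin k) (Fin r) ℝ) : (s - d) * frob Z ≤ frob (Z * N) := by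
  have h1 : s * frob Z ≤ frob (Z * Matrix.diagonal σ) := by
    apply le_of_sq_le_sq _ (frob_nn _)
    rw [mul_pow, frob_sq, frob_sq, Finset.mul_sum]
    apply Finset.sum_le_sum
    intro i _
    rw [Finset.mul_sum]
    apply Finset.sum_le_sum
    intro j _
    rw [Matrix.mul_diagonal, mul_pow, mul_comm]
    apply mul_le_mul_of_nonneg_left _ (sq_nonneg _)
    exact pow_le_pow_left₀ hs.le (hσ j) 2
  have h2 : Z * Matrix.diagonal σ = Z * N - Z * (N - Matrix.diagonal σ) := by
    rw [Matrix.mul_sub]; abel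
  have h3 := frob_sub (Z * N) (Z * (N - Matrix.diagonal σ))
  rw [← h2] at h3
  have h4 := frob_mul Z (N - Matrix.diagonal σ)
  have h5 := mul_le_mul_of_nonneg_left hN (frob_nn Z)
  nlinarith

theorem aux_unit {r : ℕ} (σ : Fin r → ℝ) (N : Matrix (Fin r) (Fin r) ℝ) (d s : ℝ) (hs : 0 < s)
    (hσ : ∀ k, s ≤ σ k) (hN : frob (N - Matrix.diagonal σ) ≤ d) (hd : d < s) : N.det ≠ 0 := by
  intro h
  obtain ⟨v, hv0, hv⟩ := Matrix.exists_vecMul_eq_zero_iff.2 h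
  set Z : Matrix (Fin 1) (Fin r) ℝ := Matrix.of (fun _ => v) with hZ
  have h1 := aux_inv σ N d s hs hσ hN Z
  have h2 : Z * N = 0 := by
    ext i j
    have := congrFun hv j
    simpa [Matrix.mul_apply, Matrix.vecMul, dotProduct, hZ] using this
  have h3 : frob (Z * N) = 0 := by rw [h2]; simp [frob]
  rw [h3] at h1
  have h4 : frob Z = 0 := by nlinarith [frob_nn Z]
  have h5 := frob_eq_zero Z h4
  apply hv0
  ext j
  have := congrFun (congrFun h5 0) j
  simpa [hZ] using this

theorem aux_half {r k : ℕ} (σ : Fin r → ℝ) (A T : Matrix (Fin r) (Fin r) ℝ) (d s : ℝ) (hs : 0 < s)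
    (hσ : ∀ k, s ≤ σ k) (hN : frob (A * T - Matrix.diagonal σ) ≤ d) (hd : d ≤ s / 100)
    (H : Matrix (Fin k) (Fin r) ℝ) (β g : ℝ) (hA : frob A ≤ β) (hg : frob (H * T) ≤ g) :
    frob H ≤ 4 / 3 * (β * g / s) := by
  have hu := aux_unit σ (A * T) d s hs hσ hN (by linarith)
  rw [Matrix.det_mul] at hu
  have hA' : IsUnit A.det := isUnit_iff_ne_zero.2 (left_ne_zero_of_mul hu)
  have h1 := aux_inv σ (A * T) d s hs hσ hN (H * A⁻¹)
  have e1 : H * A⁻¹ * (A * T) = H * T := by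
    rw [Matrix.mul_assoc, ← Matrix.mul_assoc A⁻¹, Matrix.nonsing_inv_mul _ hA', Matrix.one_mul]
  rw [e1] at h1
  have e2 : H = H * A⁻¹ * A := by
    rw [Matrix.mul_assoc, Matrix.nonsing_inv_mul _ hA', Matrix.mul_one]
  have h2 := frob_mul (H * A⁻¹) A
  rw [← e2] at h2
  have hz := frob_nn (H * A⁻¹)
  have hb : 0 ≤ β := (frob_nn A).trans hA
  have h3 : s * frob (H * A⁻¹) ≤ 4 / 3 * g := by nlinarith
  have h4 : frob H ≤ frob (H * A⁻¹) * β := h2.trans (mul_le_mul_of_nonneg_left hA hz)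
  rw [← mul_div_assoc, le_div_iff₀ hs]
  nlinarith

theorem aux_det {m n r : ℕ} (M : Matrix (Fin m) (Fin n) ℝ)
    (Uh : Matrix (Fin m) (Fin r) ℝ) (Vh : Matrix (Fin n) (Fin r) ℝ) (σ : Fin r → ℝ) (s β d : ℝ)
    (hU : Uhᵀ * Uh = 1) (hV : Vhᵀ * Vh = 1) (hs : 0 < s) (hσ : ∀ k, s ≤ σ k)
    (hM : M = Uh * Matrix.diagonal σ * Vhᵀ)
    (X : Matrix (Fin m) (Fin r) ℝ) (Y : Matrix (Fin n) (Fin r) ℝ) (hX : frob X ≤ β)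
    (hY : frob Y ≤ β) (hdd : frob (M - X * Yᵀ) = d) (hd : d ≤ s / 100) :
    ∃ (A B : Matrix (Fin r) (Fin r) ℝ), (Uh * A) * (Vh * B)ᵀ = M ∧
      frob A ≤ 1.1 * β ∧ frob B ≤ β ∧ frob (Uh * A - X) ≤ 4 / 3 * (β * d / s) ∧
      frob (Vh * B - Y) ≤ 4 / 3 * (β * d / s) := by
  set A0 := Uhᵀ * X with hA0
  set B := Vhᵀ * Y with hB
  have hd0 : 0 ≤ d := by rw [← hdd]; exact frob_nn _
  have hβ : 0 ≤ β := (frob_nn _).trans hX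
  have hA0b : frob A0 ≤ β := (frob_contr Uh hU X).trans hX
  have hBb : frob B ≤ β := (frob_contr Vh hV Y).trans hY
  have hdiag : Uhᵀ * M * Vh = Matrix.diagonal σ := by
    rw [hM]
    calc Uhᵀ * (Uh * Matrix.diagonal σ * Vhᵀ) * Vh
        = (Uhᵀ * Uh) * Matrix.diagonal σ * (Vhᵀ * Vh) := by simp only [Matrix.mul_assoc]
      _ = _ := by rw [hU, hV]; simp
  have hN : frob (A0 * Bᵀ - Matrix.diagonal σ) ≤ d := by
    have e : A0 * Bᵀ - Matrix.diagonal σ = -(Uhᵀ * ((M - X * Yᵀ) * Vh)) := by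
      rw [← hdiag, hA0, hB, Matrix.transpose_mul, Matrix.transpose_transpose]
      simp only [Matrix.sub_mul, Matrix.mul_sub, Matrix.mul_assoc]
      abel
    rw [e, frob_neg, ← hdd]
    exact (frob_contr Uh hU _).trans (frob_contr3 Vh hV _)
  have hN2 : frob (B * A0ᵀ - Matrix.diagonal σ) ≤ d := by
    rw [← frob_tr]
    simpa only [Matrix.transpose_sub, Matrix.transpose_mul, Matrix.transpose_transpose,
      Matrix.diagonal_transpose] using hN
  have hu := aux_unit σ _ d s hs hσ hN (by linarith)
  rw [Matrix.det_mul] at hu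
  have hBu : IsUnit (Bᵀ).det := isUnit_iff_ne_zero.2 (right_ne_zero_of_mul hu)
  set A := Matrix.diagonal σ * (Bᵀ)⁻¹ with hA
  have hAB : A * Bᵀ = Matrix.diagonal σ := by
    rw [hA, Matrix.mul_assoc, Matrix.nonsing_inv_mul _ hBu, Matrix.mul_one]
  have h1 : frob (Uh * A - X) ≤ 4 / 3 * (β * d / s) := by
    apply aux_half σ A0 Bᵀ d s hs hσ hN hd _ β d hA0b
    have e : (Uh * A - X) * Bᵀ = (M - X * Yᵀ) * Vh := by
      rw [Matrix.sub_mul, Matrix.sub_mul, Matrix.mul_assoc, hAB, hB, Matrix.transpose_mul,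
        Matrix.transpose_transpose, hM, Matrix.mul_assoc _ Vhᵀ, hV, Matrix.mul_one,
        Matrix.mul_assoc X]
    rw [e, ← hdd]
    exact frob_contr3 Vh hV _
  have h2 : frob (Vh * B - Y) ≤ 4 / 3 * (β * d / s) := by
    apply aux_half σ B A0ᵀ d s hs hσ hN2 hd _ β d hBb
    set W := (M - X * Yᵀ)ᵀ * Uh with hW
    have hMt : Mᵀ * Uh = Vh * Matrix.diagonal σ := by
      rw [hM]
      simp only [Matrix.transpose_mul, Matrix.transpose_transpose, Matrix.diagonal_transpose,
        Matrix.mul_assoc]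
      rw [hU, Matrix.mul_one]
    have hW' : W = Vh * Matrix.diagonal σ - Y * A0ᵀ := by
      rw [hW, Matrix.transpose_sub, Matrix.sub_mul, hMt, hA0]
      simp only [Matrix.transpose_mul, Matrix.transpose_transpose, Matrix.mul_assoc]
    have e : (Vh * B - Y) * A0ᵀ = W - Vh * (Vhᵀ * W) := by
      rw [hW', Matrix.mul_sub, Matrix.mul_sub, ← Matrix.mul_assoc Vhᵀ Vh, hV, Matrix.one_mul,
        Matrix.sub_mul, hB]
      simp only [Matrix.mul_assoc]
      abel
    rw [e, ← hdd, ← frob_tr (M - X * Yᵀ)]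
    exact (frob_contr2 Vh hV W).trans (frob_contr3 Uh hU _)
  refine ⟨A, B, ?_, ?_, hBb, h1, h2⟩
  · rw [Matrix.transpose_mul, Matrix.mul_assoc, ← Matrix.mul_assoc A, hAB, hM, Matrix.mul_assoc]
  · have e : A = Uhᵀ * (X + (Uh * A - X)) := by
      rw [add_sub_cancel, ← Matrix.mul_assoc, hU, Matrix.one_mul]
    rw [e]
    refine (frob_contr Uh hU _).trans ((frob_add _ _).trans ?_)
    have : β * d / s ≤ β / 100 := by
      rw [div_le_iff₀ hs]
      nlinarith
    linarith

theorem aux_proj {m n r : ℕ} (Ω : Finset (Fin m × Fin n)) (A : Matrix (Fin m) (Fin r) ℝ)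
    (B : Matrix (Fin n) (Fin r) ℝ) :
    frob (projOmega Ω (A * Bᵀ)) ^ 2 ≤
      ∑ i, ∑ j, (if (i, j) ∈ Ω then rowNorm A i ^ 2 * rowNorm B j ^ 2 else 0) := by
  rw [frob_sq]
  refine Finset.sum_le_sum fun i _ => Finset.sum_le_sum fun j _ => ?_
  simp only [projOmega, Matrix.of_apply]
  split_ifs with h
  · rw [Matrix.mul_apply, rowNorm_sq, rowNorm_sq]
    exact Finset.sum_mul_sq_le_sq_mul_sq _ _ _
  · simp

theorem sum_rowNorm {m r : ℕ} (A : Matrix (Fin m) (Fin r) ℝ) :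
    ∑ i, rowNorm A i ^ 2 = frob A ^ 2 := by
  rw [frob_sq]; exact Finset.sum_congr rfl fun i _ => rowNorm_sq A i

theorem row_sub {m r : ℕ} (A B : Matrix (Fin m) (Fin r) ℝ) (i : Fin m) :
    rowNorm (A - B) i ^ 2 ≤ 2 * (rowNorm A i ^ 2 + rowNorm B i ^ 2) := by
  simp only [rowNorm_sq]
  rw [← Finset.sum_add_distrib, Finset.mul_sum]
  apply Finset.sum_le_sum
  intro j _
  rw [Matrix.sub_apply]
  nlinarith [sq_nonneg (A i j + B i j)]

theorem row_le {m r : ℕ} (X : Matrix (Fin m) (Fin r) ℝ) (i : Fin m) (β q : ℝ) (hq : 0 ≤ q)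
    (h : rowNorm X i ≤ β * Real.sqrt q) : rowNorm X i ^ 2 ≤ q * β ^ 2 := by
  have h0 : 0 ≤ rowNorm X i := Real.sqrt_nonneg _
  have h1 := pow_le_pow_left₀ h0 h 2
  rw [mul_pow, Real.sq_sqrt hq] at h1
  linarith

theorem aux_arith (p m n r μ κ s d F : ℝ) (hp : 0 ≤ p) (hm : 0 < m) (hn : 0 < n) (hr : 1 ≤ r)
    (hs : 0 < s) (hκ : 1 ≤ κ) (hF0 : 0 ≤ F)
    (hF : F ≤ 16 / 9 * (r * κ * d ^ 2 / s)) (hd : 10000 * r ^ 3 * κ ^ 2 * d ^ 2 ≤ s ^ 2)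
    (hpn : 10 ^ 9 * (r ^ 6 * μ ^ 2 * κ ^ 4) ≤ p * n) :
    Real.exp 2 * p * F ^ 2 + Real.sqrt (1000 * p * m * ((9 * (r * μ / m) * (r * κ * s)) *
      (9 * (r * μ / n) * (r * κ * s))) * F ^ 2) ≤ p / 25 * d ^ 2 := by
  obtain ⟨he1, he2⟩ := aux_exp2
  have hF2 : F ^ 2 ≤ 256 / 81 * (r ^ 2 * κ ^ 2 * d ^ 4 / s ^ 2) := by
    refine (pow_le_pow_left₀ hF0 hF 2).trans (le_of_eq ?_)
    field_simp; ring
  have h1 : r ^ 2 * κ ^ 2 * d ^ 4 / s ^ 2 ≤ d ^ 2 / 10000 := by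
    rw [div_le_iff₀ (by positivity)]
    have e1 : 10000 * r ^ 2 * κ ^ 2 * d ^ 2 ≤ s ^ 2 := by
      refine le_trans ?_ hd
      have : r ^ 2 ≤ r ^ 3 := pow_le_pow_right₀ hr (by norm_num)
      gcongr
    nlinarith [mul_le_mul_of_nonneg_right e1 (sq_nonneg d)]
  have t1 : Real.exp 2 * p * F ^ 2 ≤ p / 50 * d ^ 2 := by
    have e : Real.exp 2 * p * F ^ 2 ≤ 7.4 * p * (256 / 81 * (d ^ 2 / 10000)) := by
      have : F ^ 2 ≤ 256 / 81 * (d ^ 2 / 10000) := by linarith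
      have h0 : 0 ≤ Real.exp 2 := by linarith
      gcongr
    have : 0 ≤ p * d ^ 2 := by positivity
    linarith
  have t2 : Real.sqrt (1000 * p * m * ((9 * (r * μ / m) * (r * κ * s)) *
      (9 * (r * μ / n) * (r * κ * s))) * F ^ 2) ≤ p / 50 * d ^ 2 := by
    apply Real.sqrt_le_iff.2
    refine ⟨by positivity, ?_⟩
    have e : 1000 * p * m * ((9 * (r * μ / m) * (r * κ * s)) * (9 * (r * μ / n) * (r * κ * s))) =
        81000 * p * (r ^ 4 * μ ^ 2 * κ ^ 2 * s ^ 2 / n) := by field_simp; ring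
    rw [e]
    calc 81000 * p * (r ^ 4 * μ ^ 2 * κ ^ 2 * s ^ 2 / n) * F ^ 2 ≤
        81000 * p * (r ^ 4 * μ ^ 2 * κ ^ 2 * s ^ 2 / n) *
          (256 / 81 * (r ^ 2 * κ ^ 2 * d ^ 4 / s ^ 2)) := by gcongr
      _ = 256000 * (p * d ^ 4) * (r ^ 6 * μ ^ 2 * κ ^ 4 / n) := by field_simp; ring
      _ ≤ 256000 * (p * d ^ 4) * (p / 10 ^ 9) := by
        apply mul_le_mul_of_nonneg_left _ (by positivity)
        rw [div_le_iff₀ hn]; linarith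
      _ ≤ (p / 50 * d ^ 2) ^ 2 := by
        have : 0 ≤ p ^ 2 * d ^ 4 := by positivity
        nlinarith
  linarith

set_option maxHeartbeats 1000000 in
/-- **Proposition: bound on `‖P_Ω((U-X)(V-Y)ᵀ)‖_F`.**
With probability at least `1 - 1/(2n⁴)` (uniform sampling model, by counting). -/
theorem stmt9 :
    ∃ C0 Cd CT : ℝ, 0 < C0 ∧ 0 < Cd ∧ 0 < CT ∧
      ∀ (m n r : ℕ) (μ : ℝ) (M : Matrix (Fin m) (Fin n) ℝ)
        (Uh : Matrix (Fin m) (Fin r) ℝ) (Vh : Matrix (Fin n) (Fin r) ℝ)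
        (σ : Fin r → ℝ) (Smax Smin : ℝ),
        1 ≤ n → n ≤ m → 1 ≤ r → 1 ≤ μ →
        Uhᵀ * Uh = 1 → Vhᵀ * Vh = 1 →
        (∀ k, 0 < σ k) → (∀ k l : Fin r, k ≤ l → σ l ≤ σ k) →
        M = Uh * Matrix.diagonal σ * Vhᵀ →
        ((∀ k, σ k ≤ Smax) ∧ ∃ k, σ k = Smax) →
        ((∀ k, Smin ≤ σ k) ∧ ∃ k, σ k = Smin) →
        (∀ i, ∑ k, Uh i k ^ 2 ≤ μ * r / m) →
        (∀ j, ∑ k, Vh j k ^ 2 ≤ μ * r / n) →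
        ∀ S : ℕ,
          C0 * ((m : ℝ) / n) * n * r * (Smax / Smin) ^ 2 *
              max (μ * Real.log n)
                (Real.sqrt ((m : ℝ) / n) * μ ^ 2 * (r : ℝ) ^ 6 * (Smax / Smin) ^ 4) ≤ S →
          let κ : ℝ := Smax / Smin
          let δ : ℝ := Smin / (Cd * (r : ℝ) ^ ((3 : ℝ) / 2) * κ)
          let p : ℝ := (S : ℝ) / (m * n)
          let βT : ℝ := Real.sqrt (CT * r * Smax)
          let β1 : ℝ := βT * Real.sqrt (3 * μ * r / m)
          let β2 : ℝ := βT * Real.sqrt (3 * μ * r / n)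
          (1 - 1 / (2 * (n : ℝ) ^ 4)) *
              ((Finset.powersetCard S (Finset.univ : Finset (Fin m × Fin n))).card : ℝ) ≤
            (((Finset.powersetCard S (Finset.univ : Finset (Fin m × Fin n))).filter
                (fun Ω =>
                  ∀ (X : Matrix (Fin m) (Fin r) ℝ) (Y : Matrix (Fin n) (Fin r) ℝ),
                    K1mem β1 β2 X Y → K2mem βT X Y → Kmem M δ X Y →
                    ∃ (U : Matrix (Fin m) (Fin r) ℝ) (V : Matrix (Fin n) (Fin r) ℝ),
                      U * Vᵀ = M ∧
                      (∀ i, rowNorm U i ^ 2 ≤ 3 / 2 * (r * μ / m) * βT ^ 2) ∧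
                      (∀ j, rowNorm V j ^ 2 ≤ 3 / 2 * (r * μ / n) * βT ^ 2) ∧
                      frob (U - X) * frob (V - Y) ≤
                        25 * Real.sqrt r * (βT ^ 2 / Smin ^ 2) * frob (M - X * Yᵀ) ^ 2 ∧
                      frob (projOmega Ω ((U - X) * (V - Y)ᵀ)) ^ 2 ≤
                        p / 25 * frob (M - X * Yᵀ) ^ 2)).card : ℝ) := by
  refine ⟨10 ^ 9, 100, 1, by norm_num, by norm_num, by norm_num, ?_⟩
  intro m n r μ M Uh Vh σ Smax Smin hn hnm hr hμ hU hV hσ0 _ hM hmax hmin hUi hVi S hS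
  intro κ δ p βT β1 β2
  have hn1 : (1 : ℝ) ≤ n := by exact_mod_cast hn
  have hnm' : (n : ℝ) ≤ m := by exact_mod_cast hnm
  have hm1 : (1 : ℝ) ≤ m := by linarith
  have hr1 : (1 : ℝ) ≤ r := by exact_mod_cast hr
  obtain ⟨hmax1, kmax, hkmax⟩ := hmax
  obtain ⟨hmin1, kmin, hkmin⟩ := hmin
  have hs : 0 < Smin := by rw [← hkmin]; exact hσ0 _
  have hsS : Smin ≤ Smax := (hmin1 kmax).trans (hmax1 kmax)
  have hκdef : κ = Smax / Smin := rfl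
  have hκ : 1 ≤ κ := by rw [hκdef, le_div_iff₀ hs]; linarith
  have hSκ : Smax = κ * Smin := by rw [hκdef]; field_simp
  rcases Nat.lt_or_ge (m * n) S with hbig | hSle
  · have : Finset.powersetCard S (Finset.univ : Finset (Fin m × Fin n)) = ∅ := by
      apply Finset.powersetCard_eq_empty.2
      simpa using hbig
    rw [this]; simp
  have hα : 1 ≤ (m : ℝ) / n := by rw [le_div_iff₀ (by linarith)]; linarith
  have hsα : 1 ≤ Real.sqrt ((m : ℝ) / n) := Real.one_le_sqrt.2 hα
  have hlogn : 0 ≤ Real.log n := Real.log_nonneg hn1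
  rw [← hκdef] at hS
  have hpref : (10 : ℝ) ^ 9 * ((m : ℝ) / n) * n * r * κ ^ 2 = 10 ^ 9 * m * (r * κ ^ 2) := by
    field_simp
  rw [hpref] at hS
  have hrκ : 1 ≤ r * κ ^ 2 := by nlinarith [one_le_pow₀ hκ (n := 2)]
  have hS1 : 10 ^ 9 * m * (μ * Real.log n) ≤ (S : ℝ) := by
    refine le_trans ?_ hS
    apply mul_le_mul _ (le_max_left _ _) (by positivity) (by positivity)
    nlinarith
  have hS2 : 10 ^ 9 * m * (Real.sqrt ((m : ℝ) / n) * μ ^ 2 * (r : ℝ) ^ 6 * κ ^ 4) ≤ (S : ℝ) := by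
    refine le_trans ?_ hS
    apply mul_le_mul _ (le_max_right _ _) (by positivity) (by positivity)
    nlinarith
  have hpdef : p = (S : ℝ) / (m * n) := rfl
  have hp0 : 0 ≤ p := by rw [hpdef]; positivity
  have hpn : p * n = S / m := by rw [hpdef]; field_simp
  have hbig6 : 1 ≤ μ ^ 2 * (r : ℝ) ^ 6 * κ ^ 4 := by
    have a1 : 1 ≤ μ ^ 2 := one_le_pow₀ hμ
    have a2 : 1 ≤ (r : ℝ) ^ 6 := one_le_pow₀ hr1
    have a3 : 1 ≤ κ ^ 4 := one_le_pow₀ hκ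
    exact one_le_mul_of_one_le_of_one_le (one_le_mul_of_one_le_of_one_le a1 a2) a3
  have hc1 : 10 * Real.sqrt ((m : ℝ) / n) ≤ p * n := by
    rw [hpn, le_div_iff₀ (by linarith)]
    refine le_trans ?_ hS2
    have : Real.sqrt ((m : ℝ) / n) ≤ Real.sqrt ((m : ℝ) / n) * (μ ^ 2 * (r : ℝ) ^ 6 * κ ^ 4) :=
      le_mul_of_one_le_right (by linarith) hbig6
    calc 10 * Real.sqrt ((m : ℝ) / n) * m ≤ 10 ^ 9 * m * Real.sqrt ((m : ℝ) / n) := by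
          have : 0 ≤ m * Real.sqrt ((m : ℝ) / n) := by positivity
          linarith
      _ ≤ 10 ^ 9 * m * (Real.sqrt ((m : ℝ) / n) * (μ ^ 2 * (r : ℝ) ^ 6 * κ ^ 4)) := by gcongr
      _ = _ := by ring
  have hc2 : 10 * Real.log n ≤ p * n := by
    rw [hpn, le_div_iff₀ (by linarith)]
    refine le_trans ?_ hS1
    have h1 : Real.log n ≤ μ * Real.log n := le_mul_of_one_le_left hlogn hμ
    calc 10 * Real.log n * m ≤ 10 ^ 9 * m * Real.log n := by
          have : 0 ≤ m * Real.log n := by positivity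
          linarith
      _ ≤ _ := by gcongr
  have hc3 : 10 ^ 9 * ((r : ℝ) ^ 6 * μ ^ 2 * κ ^ 4) ≤ p * n := by
    rw [hpn, le_div_iff₀ (by linarith)]
    refine le_trans ?_ hS2
    have : μ ^ 2 * (r : ℝ) ^ 6 * κ ^ 4 ≤
        Real.sqrt ((m : ℝ) / n) * (μ ^ 2 * (r : ℝ) ^ 6 * κ ^ 4) :=
      le_mul_of_one_le_left (by linarith) hsα
    calc 10 ^ 9 * ((r : ℝ) ^ 6 * μ ^ 2 * κ ^ 4) * m =
        10 ^ 9 * m * (μ ^ 2 * (r : ℝ) ^ 6 * κ ^ 4) := by ring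
      _ ≤ 10 ^ 9 * m * (Real.sqrt ((m : ℝ) / n) * (μ ^ 2 * (r : ℝ) ^ 6 * κ ^ 4)) := by gcongr
      _ = _ := by ring
  refine (aux_prob m n S hn hnm hSle p hpdef hc1 hc2).trans ?_
  apply Nat.cast_le.2
  apply Finset.card_le_card
  intro Ω hΩ
  rw [Finset.mem_filter] at hΩ ⊢
  refine ⟨hΩ.1, ?_⟩
  have hdisc := hΩ.2
  intro X Y hK1 hK2 hK
  have hβ2 : βT ^ 2 = r * κ * Smin := by
    have : 0 ≤ 1 * (r : ℝ) * Smax := by rw [hSκ]; positivity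
    rw [show βT = Real.sqrt (1 * r * Smax) from rfl, Real.sq_sqrt this, hSκ]; ring
  have hβ0 : 0 ≤ βT := Real.sqrt_nonneg _
  set d := frob (M - X * Yᵀ) with hd
  have hd0 : 0 ≤ d := frob_nn _
  set q : ℝ := (r : ℝ) ^ ((3 : ℝ) / 2) with hq
  have hq2 : q ^ 2 = (r : ℝ) ^ 3 := by
    rw [hq, ← Real.rpow_natCast, ← Real.rpow_mul (by linarith), ← Real.rpow_natCast]
    norm_num
  have hq1 : 1 ≤ q := Real.one_le_rpow hr1 (by norm_num)
  have hdK : d * (100 * q * κ) ≤ Smin := by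
    have : d ≤ Smin / (100 * q * κ) := hK
    rwa [le_div_iff₀ (by positivity)] at this
  have hd100 : d ≤ Smin / 100 := by
    have : 1 ≤ q * κ := one_le_mul_of_one_le_of_one_le hq1 hκ
    nlinarith
  have hdsq : 10000 * (r : ℝ) ^ 3 * κ ^ 2 * d ^ 2 ≤ Smin ^ 2 := by
    have := pow_le_pow_left₀ (by positivity) hdK 2
    rw [← hq2]
    nlinarith
  obtain ⟨A, B, hAB, hA, hB, hUX, hVY⟩ := aux_det M Uh Vh σ Smin βT d hU hV hs hmin1 hM X Y
    hK2.1 hK2.2 rfl hd100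
  have hμr1 : 0 < μ * r / m := by positivity
  have hμr2 : 0 < μ * r / n := by positivity
  have hUrow : ∀ i, rowNorm (Uh * A) i ^ 2 ≤ 3 / 2 * (r * μ / m) * βT ^ 2 := by
    intro i
    have a1 : frob A ^ 2 ≤ 3 / 2 * βT ^ 2 := by
      have := pow_le_pow_left₀ (frob_nn A) hA 2
      nlinarith [sq_nonneg βT]
    refine (row_mul Uh A i).trans ?_
    calc _ ≤ (μ * r / m) * (3 / 2 * βT ^ 2) :=
          mul_le_mul (hUi i) a1 (sq_nonneg _) hμr1.le
      _ = _ := by ring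
  have hVrow : ∀ j, rowNorm (Vh * B) j ^ 2 ≤ 3 / 2 * (r * μ / n) * βT ^ 2 := by
    intro i
    have a1 : frob B ^ 2 ≤ 3 / 2 * βT ^ 2 := by
      have := pow_le_pow_left₀ (frob_nn B) hB 2
      nlinarith [sq_nonneg βT]
    refine (row_mul Vh B i).trans ?_
    calc _ ≤ (μ * r / n) * (3 / 2 * βT ^ 2) :=
          mul_le_mul (hVi i) a1 (sq_nonneg _) hμr2.le
      _ = _ := by ring
  have hprod : frob (Uh * A - X) * frob (Vh * B - Y) ≤
      16 / 9 * (βT ^ 2 / Smin ^ 2 * d ^ 2) := by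
    refine (mul_le_mul hUX hVY (frob_nn _) (by positivity)).trans (le_of_eq ?_)
    field_simp; ring
  refine ⟨Uh * A, Vh * B, hAB, hUrow, hVrow, ?_, ?_⟩
  · refine hprod.trans ?_
    have h1 : 1 ≤ Real.sqrt r := Real.one_le_sqrt.2 hr1
    have h2 : 0 ≤ βT ^ 2 / Smin ^ 2 * d ^ 2 := by positivity
    have h3 : 16 / 9 ≤ 25 * Real.sqrt r := by linarith
    exact (mul_le_mul_of_nonneg_right h3 h2).trans (le_of_eq (by ring))
  · set F := frob (Uh * A - X) * frob (Vh * B - Y) with hF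
    have hF0 : 0 ≤ F := mul_nonneg (frob_nn _) (frob_nn _)
    have hFb : F ≤ 16 / 9 * (r * κ * d ^ 2 / Smin) := by
      refine hprod.trans (le_of_eq ?_)
      rw [hβ2]; field_simp
    have hrowx : ∀ i, rowNorm (Uh * A - X) i ^ 2 ≤ 9 * (r * μ / m) * (r * κ * Smin) := by
      intro i
      have h1 := row_sub (Uh * A) X i
      have h2 := row_le X i βT (3 * μ * r / m) (by positivity) (hK1.1 i)
      have h3 := hUrow i
      rw [hβ2] at h2 h3
      have h4 : 3 * μ * r / m = 3 * (r * μ / m) := by ring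
      rw [h4] at h2
      linarith
    have hrowy : ∀ j, rowNorm (Vh * B - Y) j ^ 2 ≤ 9 * (r * μ / n) * (r * κ * Smin) := by
      intro i
      have h1 := row_sub (Vh * B) Y i
      have h2 := row_le Y i βT (3 * μ * r / n) (by positivity) (hK1.2 i)
      have h3 := hVrow i
      rw [hβ2] at h2 h3
      have h4 : 3 * μ * r / n = 3 * (r * μ / n) := by ring
      rw [h4] at h2
      linarith
    have h1 := aux_bil' Ω (Real.exp 2 * p) (1000 * p * m) (by positivity) hdisc
      (fun i => rowNorm (Uh * A - X) i ^ 2) (fun j => rowNorm (Vh * B - Y) j ^ 2)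
      (9 * (r * μ / m) * (r * κ * Smin)) (9 * (r * μ / n) * (r * κ * Smin))
      (by positivity) (by positivity) (fun i => sq_nonneg _) hrowx (fun j => sq_nonneg _) hrowy
    rw [sum_rowNorm, sum_rowNorm, ← mul_pow, ← hF] at h1
    exact ((aux_proj Ω _ _).trans h1).trans (aux_arith p m n r μ κ Smin d F hp0 (by linarith)
      (by linarith) hr1 hs hκ hF0 hFb hdsq hc3)

end
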